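/- Let p > 24138 be a prime and let S be a sequence of p elements of ℤ/pℤ \ {0} containing the element 1, such that S contains no nonempty subsequence with index p and such that m(S) = M(S). Put M = M(S) and k = ⌊p/M⌋. Let 2 ≤ t < ℓ < k be integers with d = gcd(t, ℓ) < t, and let u ∈ [2, M] be an integer. If ((t−d)p − ℓ)/(tℓ) ≤ M ≤ dp/ℓ − t(u−1), then either |R_t| = 0 or |R_ℓ| ≤ (p − ℓM − 2ℓ + 1)/u + 2ℓ − 1. -/

import Mathlib

/-- `|x|ₚ`: the smallest positive integer in the residue class `x` modulo `p`
(so `|0|ₚ = p`). -/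
def nval (p : ℕ) (x : ZMod p) : ℕ := if x = 0 then p else x.val

/-- `σ(|mS|ₚ)`: the sum of `|m·a|ₚ` over all terms `a` of `S`. -/
def sigmaM (p : ℕ) (m : ℤ) (S : Multiset (ZMod p)) : ℕ :=
  (S.map fun a => nval p (m • a)).sum

/-- `σ(|S|ₚ)`: the sum of `|a|ₚ` over all terms `a` of `S`. -/
def sigmaOne (p : ℕ) (S : Multiset (ZMod p)) : ℕ :=
  (S.map (nval p)).sum

/-- `Σ_Index(S) = { σ(|T|ₚ) : T a subsequence of S with 1 ≤ σ(|T|ₚ) ≤ p }`. -/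
def SigmaIndex (p : ℕ) (S : Multiset (ZMod p)) : Set ℕ :=
  {s | ∃ T ≤ S, s = sigmaOne p T ∧ 1 ≤ s ∧ s ≤ p}

/-- `M(S)`: the maximal integer `t` such that `Σ_Index(T) = [1, t]` holds for
some subsequence `T` of `S`. -/
noncomputable def Mfun (p : ℕ) (S : Multiset (ZMod p)) : ℕ :=
  sSup {t | ∃ T ≤ S, SigmaIndex p T = Set.Icc 1 t}

/-- `m(S) = max { M(|rS|ₚ) : r ∈ [1, p-1] }`. -/
noncomputable def mfun (p : ℕ) (S : Multiset (ZMod p)) : ℕ :=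
  sSup {t | ∃ r : ℕ, 1 ≤ r ∧ r ≤ p - 1 ∧
    t = Mfun p (S.map fun x => (r : ZMod p) * x)}

/-- `Rᵢ`: the subsequence of `S` consisting of those terms `x` with
`1 ≤ |ix|ₚ ≤ M` and `gcd(|ix|ₚ, i) = 1`. -/
def Rseq (p : ℕ) (M : ℕ) (S : Multiset (ZMod p)) (i : ℕ) : Multiset (ZMod p) :=
  S.filter fun x => 1 ≤ nval p ((i : ZMod p) * x) ∧
    nval p ((i : ZMod p) * x) ≤ M ∧ Nat.Coprime (nval p ((i : ZMod p) * x)) i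

lemma aux_cover {α : Type*} (l : ℕ) [NeZero l] (f : α → ℕ) (X : Multiset α)
    (hX : ∀ x ∈ X, Nat.Coprime (f x) l) :
    (∀ r : ZMod l, ∃ Y ≤ X, (((Y.map f).sum : ℕ) : ZMod l) = r) ∨
      Multiset.card X + 1 ≤
        Set.ncard {r : ZMod l | ∃ Y ≤ X, (((Y.map f).sum : ℕ) : ZMod l) = r} := by
  induction X using Multiset.induction_on with
  | empty =>
    right
    have : {r : ZMod l | ∃ Y ≤ (0 : Multiset α), (((Y.map f).sum : ℕ) : ZMod l) = r} = {0} := by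
      ext r
      simp [eq_comm]
    rw [this]
    simp
  | cons a X ih =>
    have ih := ih (fun x hx => hX x (Multiset.mem_cons_of_mem hx))
    rcases ih with ih | ih
    · left
      intro r
      obtain ⟨Y, hY, h⟩ := ih r
      exact ⟨Y, hY.trans (Multiset.le_cons_self _ _), h⟩
    · set A := {r : ZMod l | ∃ Y ≤ X, (((Y.map f).sum : ℕ) : ZMod l) = r} with hA
      set B := {r : ZMod l | ∃ Y ≤ a ::ₘ X, (((Y.map f).sum : ℕ) : ZMod l) = r} with hB
      have hAB : A ⊆ B := by
        rintro r ⟨Y, hY, h⟩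
        exact ⟨Y, hY.trans (Multiset.le_cons_self _ _), h⟩
      have hAB2 : ∀ r ∈ A, (f a : ZMod l) + r ∈ B := by
        rintro r ⟨Y, hY, h⟩
        refine ⟨a ::ₘ Y, (Multiset.cons_le_cons_iff a).2 hY, ?_⟩
        rw [Multiset.map_cons, Multiset.sum_cons, Nat.cast_add, h]
      by_cases hlt : A.ncard < B.ncard
      · right
        rw [Multiset.card_cons]
        omega
      · left
        have heq : A = B := Set.eq_of_subset_of_ncard_le hAB (by omega) (Set.toFinite _)
        have hmul : ∀ n : ℕ, ((n * f a : ℕ) : ZMod l) ∈ B := by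
          intro n
          induction n with
          | zero => exact ⟨0, Multiset.zero_le _, by simp⟩
          | succ n ihn =>
            have := hAB2 _ (heq ▸ ihn)
            convert this using 1
            push_cast
            ring
        intro r
        have hu : IsUnit ((f a : ℕ) : ZMod l) :=
          (ZMod.isUnit_iff_coprime _ _).2 (hX a (Multiset.mem_cons_self _ _))
        obtain ⟨v, hv⟩ := hu
        have := hmul ((r * (↑v⁻¹ : ZMod l)).val)
        rw [Nat.cast_mul, ZMod.natCast_zmod_val, ← hv, mul_assoc, Units.inv_mul, mul_one] at this
        exact this

lemma aux_cover2 {α : Type*} (l : ℕ) [NeZero l] (f : α → ℕ) (X : Multiset α)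
    (hX : ∀ x ∈ X, Nat.Coprime (f x) l) (hc : l ≤ Multiset.card X + 1) (r : ZMod l) :
    ∃ Y ≤ X, (((Y.map f).sum : ℕ) : ZMod l) = r := by
  rcases aux_cover l f X hX with h | h
  · exact h r
  · have huniv : {r : ZMod l | ∃ Y ≤ X, (((Y.map f).sum : ℕ) : ZMod l) = r} = Set.univ := by
      apply Set.eq_of_subset_of_ncard_le (Set.subset_univ _) _ (Set.toFinite _)
      rw [Set.ncard_univ, Nat.card_zmod]
      omega
    have : r ∈ (Set.univ : Set (ZMod l)) := trivial
    rw [← huniv] at this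
    exact this

lemma aux_prefix {α : Type*} (f : α → ℕ) (M Q : ℕ) (B : Multiset α)
    (hB : ∀ x ∈ B, f x ≤ M) (hQ : Q ≤ (B.map f).sum) :
    ∃ Y ≤ B, Q ≤ (Y.map f).sum ∧ (Y.map f).sum ≤ Q + M := by
  induction B using Multiset.induction_on with
  | empty => exact ⟨0, le_rfl, hQ, by simp⟩
  | cons a B ih =>
    by_cases h : Q ≤ (B.map f).sum
    · obtain ⟨Y, hY, h1⟩ := ih (fun x hx => hB x (Multiset.mem_cons_of_mem hx)) h
      exact ⟨Y, hY.trans (Multiset.le_cons_self _ _), h1⟩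
    · refine ⟨a ::ₘ B, le_rfl, hQ, ?_⟩
      have := hB a (Multiset.mem_cons_self _ _)
      rw [Multiset.map_cons, Multiset.sum_cons]
      omega

lemma aux_exists_le {α : Type*} {s : Multiset α} {n : ℕ} (h : n ≤ Multiset.card s) :
    ∃ t ≤ s, Multiset.card t = n := by
  induction s using Quotient.inductionOn with
  | h L =>
    refine ⟨(L.take n : List α), ?_, ?_⟩
    · exact Multiset.coe_le.2 (List.take_sublist n L).subperm
    · simpa using h

lemma aux_sum_le {α : Type*} (f : α → ℕ) {Y X : Multiset α} (h : Y ≤ X) :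
    (Y.map f).sum ≤ (X.map f).sum := by
  obtain ⟨Z, rfl⟩ := Multiset.le_iff_exists_add.1 h
  simp

lemma aux_sum_le_card {α : Type*} (f : α → ℕ) (c : ℕ) (X : Multiset α) (h : ∀ x ∈ X, f x ≤ c) :
    (X.map f).sum ≤ Multiset.card X * c := by
  have := Multiset.sum_le_card_nsmul (X.map f) c (by
    intro x hx
    obtain ⟨a, ha, rfl⟩ := Multiset.mem_map.1 hx
    exact h a ha)
  simpa using this

lemma aux_card_le_sum {α : Type*} (f : α → ℕ) (c : ℕ) (X : Multiset α) (h : ∀ x ∈ X, c ≤ f x) :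
    Multiset.card X * c ≤ (X.map f).sum := by
  have := Multiset.card_nsmul_le_sum (s := X.map f) (a := c) (by
    intro x hx
    obtain ⟨a, ha, rfl⟩ := Multiset.mem_map.1 hx
    exact h a ha)
  simpa using this

/-- The value `|i x|` satisfies `i * |x| = |i x| + j p`. -/
lemma aux_nval {p : ℕ} (hp : p.Prime) (i : ℕ) (x : ZMod p) (hx : x ≠ 0) (hi0 : 0 < i)
    (hip : i < p) :
    ∃ j : ℕ, i * nval p x = nval p ((i : ZMod p) * x) + j * p ∧
      nval p ((i : ZMod p) * x) < p ∧ 0 < nval p ((i : ZMod p) * x) := by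
  have := Fact.mk hp
  have hi : (i : ZMod p) ≠ 0 := by
    intro h
    rw [ZMod.natCast_eq_zero_iff] at h
    exact absurd (Nat.le_of_dvd hi0 h) (by omega)
  have hne : (i : ZMod p) * x ≠ 0 := mul_ne_zero hi hx
  refine ⟨(i * x.val) / p, ?_, ?_, ?_⟩
  · rw [nval, nval, if_neg hx, if_neg hne, ZMod.val_mul, ZMod.val_natCast,
      Nat.mod_eq_of_lt hip]
    exact (Nat.mod_add_div' _ _).symm
  · rw [nval, if_neg hne]; exact ZMod.val_lt _
  · rw [nval, if_neg hne]; exact Nat.pos_of_ne_zero (by simpa using ⟨hi, hx⟩)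

/-- small values just scale -/
lemma aux_nval_small {p : ℕ} (hp : p.Prime) (i : ℕ) (x : ZMod p) (hx : x ≠ 0) (hi0 : 0 < i)
    (hip : i < p) (h : i * nval p x < p) :
    nval p ((i : ZMod p) * x) = i * nval p x := by
  obtain ⟨j, h1, h2, h3⟩ := aux_nval hp i x hx hi0 hip
  have : j = 0 := by
    by_contra hj
    have : 1 * p ≤ j * p := Nat.mul_le_mul_right _ (by omega)
    omega
  subst this
  omega

lemma aux_num (p t l d M b j w i v : ℕ) (hp : p.Prime) (hl0 : 0 < l) (ht : 2 ≤ t)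
    (hd : d = Nat.gcd t l) (hdt : d < t) (hlM : l * M < p)
    (hb0 : 0 < b) (hbM : b ≤ M) (hbt : Nat.Coprime b t)
    (h1 : t * v = b + j * p) (h2 : l * v = w + i * p) (hw : w < p) :
    0 < j ∧ (t : ℤ) * ((p : ℤ) - w) ≤ ((t : ℤ) - d) * p - l ∧
      (d : ℤ) * p - l * M ≤ (t : ℤ) * ((p : ℤ) - w) := by
  have hp0 : (0 : ℤ) < p := by exact_mod_cast hp.pos
  have hjt : Nat.Coprime j t := by
    refine Nat.Coprime.symm ?_
    have hdj : Nat.gcd t j ∣ b := by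
      have e1 : Nat.gcd t j ∣ t * v := (Nat.gcd_dvd_left t j).mul_right v
      have e2 : Nat.gcd t j ∣ j * p := (Nat.gcd_dvd_right t j).mul_right p
      rw [h1] at e1
      exact (Nat.dvd_add_left e2).1 e1
    have := Nat.dvd_gcd hdj (Nat.gcd_dvd_left t j)
    rw [hbt] at this
    exact Nat.dvd_one.1 this
  have hdl : (d : ℤ) ∣ l := by rw [hd]; exact_mod_cast Nat.gcd_dvd_right t l
  have hdtt : (d : ℤ) ∣ t := by rw [hd]; exact_mod_cast Nat.gcd_dvd_left t l
  obtain ⟨c, hc⟩ : ∃ c : ℤ, c = (l : ℤ) * j - t * i := ⟨_, rfl⟩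
  have hdc : (d : ℤ) ∣ c := hc ▸ dvd_sub (hdl.mul_right _) (hdtt.mul_right _)
  have h1' : (t : ℤ) * v = b + j * p := by exact_mod_cast h1
  have h2' : (l : ℤ) * v = w + i * p := by exact_mod_cast h2
  have key : (t : ℤ) * w = l * b + c * p := by
    rw [hc]; linear_combination (l : ℤ) * h1' - (t : ℤ) * h2'
  have hc0 : c ≠ 0 := by
    intro h0
    have e : l * j = t * i := by
      have : (l : ℤ) * j = t * i := by linarith
      exact_mod_cast this
    have e2 : t ∣ l := hjt.symm.dvd_of_dvd_mul_right ⟨i, e⟩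
    rw [Nat.gcd_eq_left e2] at hd
    omega
  have hlb : (l : ℤ) * b < p := by
    have : l * b ≤ l * M := Nat.mul_le_mul_left _ hbM
    exact_mod_cast lt_of_le_of_lt this hlM
  have hlb' : (l : ℤ) * b ≤ l * M := by
    exact_mod_cast Nat.mul_le_mul_left l hbM
  have hlb0 : (l : ℤ) ≤ l * b := by
    exact_mod_cast Nat.le_mul_of_pos_right l hb0
  have hl0' : (0 : ℤ) < l := by exact_mod_cast hl0
  have ht0 : (0 : ℤ) < t := by exact_mod_cast (by omega : 0 < t)
  have hw' : (w : ℤ) < p := by exact_mod_cast hw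
  have hcpos : 0 < c := by
    have : -1 < c := by
      by_contra hh
      have : c * p ≤ -1 * p := mul_le_mul_of_nonneg_right (by omega) hp0.le
      have : (0 : ℤ) ≤ t * w := by positivity
      linarith
    omega
  have hct : c < t := by
    by_contra hh
    have : (t : ℤ) * p ≤ c * p := mul_le_mul_of_nonneg_right (by omega) hp0.le
    have : (t : ℤ) * w < t * p := mul_lt_mul_of_pos_left hw' ht0
    linarith
  have g1 : (d : ℤ) ≤ c := Int.le_of_dvd hcpos hdc
  have g2 : (d : ℤ) ≤ t - c := Int.le_of_dvd (by omega) (dvd_sub hdtt hdc)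
  refine ⟨?_, ?_, ?_⟩
  · rcases Nat.eq_zero_or_pos j with h | h
    · subst h
      have : (0 : ℤ) ≤ t * i := by positivity
      simp at hc
      linarith
    · exact h
  · have : (d : ℤ) * p ≤ c * p := mul_le_mul_of_nonneg_right g1 hp0.le
    linarith
  · have : (d : ℤ) * p ≤ (t - c) * p := mul_le_mul_of_nonneg_right g2 hp0.le
    linarith

lemma aux_Mfun (p : ℕ) (S : Multiset (ZMod p)) :
    ∃ T ≤ S, SigmaIndex p T = Set.Icc 1 (Mfun p S) := by
  have hbdd : BddAbove {t | ∃ T ≤ S, SigmaIndex p T = Set.Icc 1 t} := by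
    refine ⟨p, ?_⟩
    rintro t ⟨T, hT, h⟩
    rcases Nat.eq_zero_or_pos t with h0 | h0
    · omega
    · have : t ∈ SigmaIndex p T := by rw [h]; exact ⟨h0, le_rfl⟩
      obtain ⟨_, _, _, _, h⟩ := this
      exact h
  have hne : {t | ∃ T ≤ S, SigmaIndex p T = Set.Icc 1 t}.Nonempty := by
    refine ⟨0, 0, Multiset.zero_le _, ?_⟩
    ext s
    simp only [SigmaIndex, Set.mem_ofPred_eq, Set.mem_Icc]
    constructor
    · rintro ⟨T, hT, h1, h2, h3⟩
      have : T = 0 := Multiset.le_zero.1 hT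
      subst this
      simp [sigmaOne] at h1
      omega
    · intro h
      omega
  exact Nat.sSup_mem hne hbdd

/-- Lemma 4.6: with `M = M(S)`, `k = ⌊p/M⌋`, `2 ≤ t < ℓ < k`, `d = gcd(t, ℓ) < t`
and `u ∈ [2, M]`, if `((t-d)p - ℓ)/(tℓ) ≤ M ≤ dp/ℓ - t(u-1)`, then either
`|R_t| = 0` or `|R_ℓ| ≤ (p - ℓM - 2ℓ + 1)/u + 2ℓ - 1`. -/
theorem stmt_11 (p : ℕ) (hp : p.Prime) (hbig : 24138 < p)
    (S : Multiset (ZMod p)) (hcard : Multiset.card S = p)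
    (h0 : (0 : ZMod p) ∉ S) (h1 : (1 : ZMod p) ∈ S)
    (hno : ¬ ∃ T ≤ S, T ≠ 0 ∧ ∃ m : ℤ, IsCoprime m (p : ℤ) ∧ sigmaM p m T = p)
    (hmM : mfun p S = Mfun p S)
    (M k : ℕ) (hM : M = Mfun p S) (hk : k = p / M)
    (t l d u : ℕ) (ht : 2 ≤ t) (htl : t < l) (hlk : l < k)
    (hd : d = Nat.gcd t l) (hdt : d < t)
    (hu2 : 2 ≤ u) (huM : u ≤ M)
    (hlow : (((t : ℚ) - d) * p - l) / ((t : ℚ) * l) ≤ (M : ℚ))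
    (hhigh : (M : ℚ) ≤ (d : ℚ) * p / l - (t : ℚ) * ((u : ℚ) - 1)) :
    Multiset.card (Rseq p M S t) = 0 ∨
      (Multiset.card (Rseq p M S l) : ℚ) ≤
        ((p : ℚ) - (l : ℚ) * M - 2 * l + 1) / u + 2 * l - 1 := by
  subst hM
  set M := Mfun p S with hMdef
  clear_value M
  clear hmM hcard hbig
  have hM0 : 0 < M := by omega
  have hkM : k * M ≤ p := by rw [hk]; exact Nat.div_mul_le_self p M
  have hlM1 : (l + 1) * M ≤ p := le_trans (Nat.mul_le_mul_right M hlk) hkM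
  have hlM2 : l * M + M ≤ p := by rw [← Nat.succ_mul]; exact hlM1
  have hlM : l * M < p := by omega
  have htM : t * M < p := lt_of_le_of_lt (Nat.mul_le_mul_right M htl.le) hlM
  have hlp : l < p := lt_of_le_of_lt (Nat.le_mul_of_pos_right l hM0) hlM
  have htp : t < p := htl.trans hlp
  have : NeZero l := ⟨by omega⟩
  obtain ⟨T, hTS, hT⟩ : ∃ T ≤ S, SigmaIndex p T = Set.Icc 1 M := by
    rw [hMdef]; exact aux_Mfun p S
  have hSne : ∀ x ∈ S, x ≠ 0 := fun x hx h => h0 (h ▸ hx)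
  have hnv : ∀ x ∈ S, 0 < nval p x ∧ nval p x ≤ p := by
    intro x hx
    have := Fact.mk hp
    rw [nval, if_neg (hSne x hx)]
    exact ⟨Nat.pos_of_ne_zero (by simpa using hSne x hx), (ZMod.val_lt x).le⟩
  have hTle : ∀ x ∈ T, nval p x ≤ M := by
    intro x hx
    have : nval p x ∈ SigmaIndex p T :=
      ⟨{x}, Multiset.singleton_le.2 hx, by simp [sigmaOne],
        (hnv x (Multiset.mem_of_le hTS hx)).1, (hnv x (Multiset.mem_of_le hTS hx)).2⟩
    rw [hT] at this
    exact this.2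
  obtain ⟨f, hf⟩ : ∃ f : ZMod p → ℕ, f = fun x => nval p ((l : ZMod p) * x) := ⟨_, rfl⟩
  have hfT : ∀ x ∈ S, nval p x ≤ M → f x = l * nval p x := by
    intro x hx hxM
    rw [hf]
    exact aux_nval_small hp l x (hSne x hx) (by omega) hlp
      (lt_of_le_of_lt (Nat.mul_le_mul_left l hxM) hlM)
  have hTsum : ∀ s ≤ M, ∃ U ≤ T, (U.map f).sum = l * s := by
    intro s hs
    rcases Nat.eq_zero_or_pos s with h | h
    · exact ⟨0, Multiset.zero_le _, by simp [h]⟩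
    · have : s ∈ SigmaIndex p T := by rw [hT]; exact ⟨h, hs⟩
      obtain ⟨U, hU, hs, -, -⟩ := this
      refine ⟨U, hU, ?_⟩
      rw [hs, sigmaOne, ← Multiset.sum_map_mul_left]
      congr 1
      apply Multiset.map_congr rfl
      intro x hx
      exact hfT x (Multiset.mem_of_le (hU.trans hTS) hx) (hTle x (Multiset.mem_of_le hU hx))
  -- the final contradiction form
  have hno' : ∀ W ≤ S, (W.map f).sum ≠ p := by
    intro W hW h
    apply hno
    refine ⟨W, hW, ?_, (l : ℤ), ?_, ?_⟩
    · rintro rfl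
      simp at h
      exact hp.ne_zero h.symm
    · rw [Nat.isCoprime_iff_coprime, Nat.coprime_comm]
      exact (Nat.Prime.coprime_iff_not_dvd hp).2
        (fun h => absurd (Nat.le_of_dvd (by omega) h) (by omega))
    · refine Eq.trans ?_ h
      rw [sigmaM, hf]
      simp
  obtain ⟨R, hR⟩ : ∃ R, R = Rseq p M S l := ⟨_, rfl⟩
  have hRS : R ≤ S := by rw [hR]; exact Multiset.filter_le _ _
  have hRf : ∀ x ∈ R, 0 < f x ∧ f x ≤ M ∧ Nat.Coprime (f x) l := by
    intro x hx
    rw [hR, Rseq, Multiset.mem_filter] at hx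
    rw [hf]
    exact hx.2
  have hRbig : ∀ x ∈ R, M < nval p x := by
    intro x hx
    by_contra hh
    have h1 := hfT x (Multiset.mem_of_le hRS hx) (by omega)
    have h2 := (hRf x hx).2.2
    rw [h1] at h2
    have := Nat.Coprime.eq_one_of_dvd h2.symm (Dvd.intro _ rfl)
    omega
  have hTT : T ≤ S.filter (fun x => nval p x ≤ M) :=
    Multiset.le_filter.2 ⟨hTS, hTle⟩
  have hjoin : ∀ Z ≤ S, (∀ x ∈ Z, M < nval p x) → ∀ U ≤ T, Z + U ≤ S := by
    intro Z hZ hZ2 U hU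
    have : Z ≤ S.filter (fun x => ¬ nval p x ≤ M) :=
      Multiset.le_filter.2 ⟨hZ, fun x hx => not_le.2 (hZ2 x hx)⟩
    have h2 := Multiset.filter_add_not (fun x => nval p x ≤ M) S
    calc Z + U ≤ S.filter (fun x => ¬ nval p x ≤ M) + S.filter (fun x => nval p x ≤ M) :=
          add_le_add this (hU.trans hTT)
      _ = S := by rw [add_comm]; exact h2
  -- core step
  have core : ∀ X ≤ R, Multiset.card X = l - 1 → ∀ N, (X.map f).sum ≤ N → N ≤ l * M →
      ∃ Y ≤ X, ∃ U ≤ T, (Y.map f).sum + (U.map f).sum = N := by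
    intro X hX hXc N h1 h2
    obtain ⟨Y, hY, hYN⟩ := aux_cover2 l f X
      (fun x hx => (hRf x (Multiset.mem_of_le hX hx)).2.2) (by omega) (N : ZMod l)
    have hYle := (aux_sum_le f hY).trans h1
    rw [ZMod.natCast_eq_natCast_iff] at hYN
    obtain ⟨s, hs⟩ := (Nat.modEq_iff_dvd' hYle).1 hYN
    have hsM : s ≤ M := by
      have : l * s ≤ l * M := by omega
      exact Nat.le_of_mul_le_mul_left this (by omega)
    obtain ⟨U, hU, hUs⟩ := hTsum s hsM
    exact ⟨Y, hY, U, hU, by omega⟩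
  by_cases hRt : Multiset.card (Rseq p M S t) = 0
  · exact Or.inl hRt
  right
  obtain ⟨y, hy⟩ := Multiset.card_pos_iff_exists_mem.1 (Nat.pos_of_ne_zero hRt)
  rw [Rseq, Multiset.mem_filter] at hy
  obtain ⟨hyS, hb0, hbM, hbt⟩ := hy
  obtain ⟨j, hj1, hj2, -⟩ := aux_nval hp t y (hSne y hyS) (by omega) htp
  obtain ⟨i, hi1, hi2, -⟩ := aux_nval hp l y (hSne y hyS) (by omega) hlp
  have hfy : nval p ((l : ZMod p) * y) = f y := by rw [hf]
  rw [hfy] at hi1 hi2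
  obtain ⟨hj0, hn1, hn2⟩ := aux_num p t l d M _ j (f y) i (nval p y) hp (by omega) ht hd hdt hlM
    hb0 hbM hbt hj1 hi1 hi2
  obtain ⟨N, hN⟩ : ∃ N, N + f y = p := ⟨p - f y, by omega⟩
  have hNz : (p : ℤ) - f y = N := by rw [← hN]; push_cast; ring
  rw [hNz] at hn1 hn2
  have ht0q : (0 : ℚ) < t := by exact_mod_cast (by omega : 0 < t)
  have hl0q : (0 : ℚ) < l := by exact_mod_cast (by omega : 0 < l)
  have hNle : N ≤ l * M := by
    have h1 : ((t : ℚ) - d) * p - l ≤ M * (t * l) := (div_le_iff₀ (by positivity)).1 hlow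
    have h2 : (t : ℚ) * N ≤ ((t : ℚ) - d) * p - l := by exact_mod_cast hn1
    have h3 : (t : ℚ) * N ≤ t * (l * M) := by linarith
    have := le_of_mul_le_mul_left h3 ht0q
    exact_mod_cast this
  have hNge : l * (u - 1) ≤ N := by
    have h1 : (M : ℚ) + (t : ℚ) * ((u : ℚ) - 1) ≤ (d : ℚ) * p / l := by linarith
    rw [le_div_iff₀ hl0q] at h1
    have h2 : (d : ℚ) * p - l * M ≤ (t : ℚ) * N := by exact_mod_cast hn2
    have h3 : (t : ℚ) * (l * ((u : ℚ) - 1)) ≤ t * N := by linarith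
    have h4 := le_of_mul_le_mul_left h3 ht0q
    have h5 : ((u - 1 : ℕ) : ℚ) = (u : ℚ) - 1 := by
      rw [Nat.cast_sub (by omega)]; simp
    rw [← h5] at h4
    exact_mod_cast h4
  have hyM : M < nval p y := by
    by_contra hh
    have h1 : t * nval p y ≤ t * M := Nat.mul_le_mul_left t (by omega)
    have h2 : 1 * p ≤ j * p := Nat.mul_le_mul_right p hj0
    omega
  -- small and big parts
  obtain ⟨A, hA⟩ : ∃ A, A = R.filter (fun x => f x < u) := ⟨_, rfl⟩
  obtain ⟨B, hB⟩ : ∃ B, B = R.filter (fun x => ¬ f x < u) := ⟨_, rfl⟩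
  have hABR : A + B = R := by rw [hA, hB]; exact Multiset.filter_add_not _ _
  have hAu : ∀ x ∈ A, f x < u := by
    intro x hx; rw [hA] at hx; exact (Multiset.mem_filter.1 hx).2
  have hBu : ∀ x ∈ B, u ≤ f x := by
    intro x hx; rw [hB] at hx; exact not_lt.1 (Multiset.mem_filter.1 hx).2
  have hAR : A ≤ R := by rw [hA]; exact Multiset.filter_le _ _
  have hBR : B ≤ R := by rw [hB]; exact Multiset.filter_le _ _
  have hAcard : Multiset.card A < l - 1 := by
    by_contra hh
    obtain ⟨X, hXA, hXc⟩ := aux_exists_le (s := A) (n := l - 1) (by omega)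
    have hs : (X.map f).sum ≤ N := by
      have h1 := aux_sum_le_card f (u - 1) X
        (fun x hx => by have := hAu x (Multiset.mem_of_le hXA hx); omega)
      have h2 : Multiset.card X * (u - 1) ≤ l * (u - 1) :=
        Nat.mul_le_mul_right _ (by omega)
      omega
    obtain ⟨Y, hY, U, hU, hsum⟩ := core X (hXA.trans hAR) hXc N hs hNle
    have hYA := hY.trans hXA
    have hynot : y ∉ Y := by
      intro h
      have := hAu y (Multiset.mem_of_le hYA h)
      omega
    have hyY : y ::ₘ Y ≤ S :=
      (Multiset.cons_le_of_notMem hynot).2 ⟨hyS, hYA.trans (hAR.trans hRS)⟩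
    refine hno' (y ::ₘ Y + U) (hjoin _ hyY ?_ U hU) ?_
    · intro x hx
      rcases Multiset.mem_cons.1 hx with rfl | hx
      · exact hyM
      · exact hRbig x (Multiset.mem_of_le (hYA.trans hAR) hx)
    · rw [Multiset.map_add, Multiset.sum_add, Multiset.map_cons, Multiset.sum_cons]
      omega
  -- counting
  by_contra hcon
  rw [← hR] at hcon
  push Not at hcon
  have hcardR : Multiset.card A + Multiset.card B = Multiset.card R := by
    rw [← hABR, Multiset.card_add]
  have hu0q : (0 : ℚ) < u := by exact_mod_cast (by omega : 0 < u)
  have hcz : (p : ℤ) - l * M - 2 * l + 1 < (Multiset.card R - 2 * l + 1) * u := by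
    have : ((p : ℚ) - (l : ℚ) * M - 2 * l + 1) / u < Multiset.card R - 2 * l + 1 := by linarith
    rw [div_lt_iff₀ hu0q] at this
    exact_mod_cast this
  have hlMz : (l : ℤ) * M < p := by exact_mod_cast hlM
  have hluz : (2 : ℤ) * l ≤ u * l := by exact_mod_cast Nat.mul_le_mul_right l hu2
  have hcz2 : (p : ℤ) - l * M < (Multiset.card R - l + 1) * u := by
    linarith
  have hRl : l ≤ Multiset.card R := by
    by_contra hh
    have h1 : (Multiset.card R : ℤ) - l + 1 ≤ 0 := by omega
    have := mul_nonpos_of_nonpos_of_nonneg h1 (by positivity : (0 : ℤ) ≤ u)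
    linarith
  obtain ⟨Y, hYB, hYc⟩ := aux_exists_le (s := B) (n := l - 1 - Multiset.card A)
    (by omega)
  obtain ⟨C, rfl⟩ := Multiset.le_iff_exists_add.1 hYB
  have hCc : Multiset.card C + (l - 1) = Multiset.card R := by
    rw [Multiset.card_add] at hcardR
    omega
  have hCsum := aux_card_le_sum f u C (fun x hx => hBu x (Multiset.mem_add.2 (Or.inr hx)))
  have hCQ : p - l * M ≤ (C.map f).sum := by
    have h1 : (Multiset.card C : ℤ) = Multiset.card R - l + 1 := by omega
    rw [← h1] at hcz2
    have h2 : p < l * M + Multiset.card C * u := by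
      have : (p : ℤ) < l * M + Multiset.card C * u := by linarith
      exact_mod_cast this
    omega
  have hCR : C ≤ R := (Multiset.le_add_left _ _).trans hBR
  obtain ⟨D, hDC, hD1, hD2⟩ := aux_prefix f M (p - l * M) C
    (fun x hx => (hRf x (Multiset.mem_of_le hCR hx)).2.1) hCQ
  have hXR : A + Y ≤ R := by
    rw [← hABR, ← add_assoc]; exact Multiset.le_add_right _ _
  have hXc : Multiset.card (A + Y) = l - 1 := by
    rw [Multiset.card_add]; omega
  have hXs := aux_sum_le_card f M (A + Y)
    (fun x hx => (hRf x (Multiset.mem_of_le hXR hx)).2.1)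
  rw [hXc, Nat.sub_mul, one_mul] at hXs
  have hMl : M ≤ l * M := Nat.le_mul_of_pos_left M (by omega)
  obtain ⟨Z, hZ, U, hU, hsum⟩ := core (A + Y) hXR hXc (p - (D.map f).sum) (by omega) (by omega)
  have hZD : Z + D ≤ R := by
    rw [← hABR, ← add_assoc]
    exact add_le_add hZ hDC
  refine hno' (Z + D + U) (hjoin _ (hZD.trans hRS)
    (fun x hx => hRbig x (Multiset.mem_of_le hZD hx)) U hU) ?_
  rw [Multiset.map_add, Multiset.sum_add, Multiset.map_add, Multiset.sum_add]
  omega
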